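/- For the A-module M := A ⊕ D(A) one has Ext¹_A(M, M) = 0, i.e. M is rigid. -/

import Mathlib

/-!
We formalize statements about the algebra `A = kQ/J²`, where `Q` is the quiver
`1 ⇄ 2 ⇄ 3` and `J` is the arrow ideal of the path algebra `kQ`.
The algebra `A` is presented by generators and relations as a quotient of the
free algebra on three vertex idempotents and four arrows.
Right `A`-modules are treated as left modules over `Aᵐᵒᵖ`.
-/

open CategoryTheory Opposite

/-- Generators of the path algebra `kQ`: three vertex idempotents `e i`
and four arrows `ar a`, where the arrows of `Q` are
`α : 1 → 2`, `β : 2 → 1`, `γ : 2 → 3`, `δ : 3 → 2`. -/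
inductive QGen : Type
  | e : Fin 3 → QGen
  | ar : Fin 4 → QGen

/-- The sources of the four arrows `α, β, γ, δ` (vertices `1,2,3` are `0,1,2 : Fin 3`). -/
def arrowSrc : Fin 4 → Fin 3 := ![0, 1, 1, 2]

/-- The targets of the four arrows `α, β, γ, δ`. -/
def arrowTgt : Fin 4 → Fin 3 := ![1, 0, 2, 1]

/-- The defining relations of `A = kQ/J²`: the `e i` are orthogonal idempotents summing
to `1`, the arrows are compatible with their sources and targets, and any product of
two arrows vanishes (`J² = 0`). -/
inductive ARel (k : Type) [Field k] : FreeAlgebra k QGen → FreeAlgebra k QGen → Prop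
  | idem (i j : Fin 3) :
      ARel k (FreeAlgebra.ι k (QGen.e i) * FreeAlgebra.ι k (QGen.e j))
        (if i = j then FreeAlgebra.ι k (QGen.e i) else 0)
  | sum : ARel k
      (FreeAlgebra.ι k (QGen.e 0) + FreeAlgebra.ι k (QGen.e 1) + FreeAlgebra.ι k (QGen.e 2)) 1
  | src (a : Fin 4) :
      ARel k (FreeAlgebra.ι k (QGen.e (arrowSrc a)) * FreeAlgebra.ι k (QGen.ar a))
        (FreeAlgebra.ι k (QGen.ar a))
  | tgt (a : Fin 4) :
      ARel k (FreeAlgebra.ι k (QGen.ar a) * FreeAlgebra.ι k (QGen.e (arrowTgt a)))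
        (FreeAlgebra.ι k (QGen.ar a))
  | radsq (a b : Fin 4) :
      ARel k (FreeAlgebra.ι k (QGen.ar a) * FreeAlgebra.ι k (QGen.ar b)) 0

/-- The algebra `A = kQ/J²`. -/
abbrev AlgA (k : Type) [Field k] : Type := RingQuot (ARel k)

/-- Right `A`-modules are left modules over `Aop k = Aᵐᵒᵖ`. -/
abbrev Aop (k : Type) [Field k] : Type := (AlgA k)ᵐᵒᵖ

/-- The algebra homomorphism `A → k` corresponding to the vertex `i`. -/
noncomputable def simpleAlgHom (k : Type) [Field k] (i : Fin 3) : AlgA k →ₐ[k] k :=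
  RingQuot.liftAlgHom k
    ⟨FreeAlgebra.lift k (fun g => match g with
        | QGen.e j => if j = i then (1 : k) else 0
        | QGen.ar _ => 0), by
      intro _x _y h
      induction h with
      | idem i j =>
          simp only [map_mul, FreeAlgebra.lift_ι_apply, apply_ite, map_zero]
          split_ifs <;> simp_all
      | sum =>
          simp only [map_add, map_one, FreeAlgebra.lift_ι_apply]
          fin_cases i <;> simp
      | src a => simp [FreeAlgebra.lift_ι_apply]
      | tgt a => simp [FreeAlgebra.lift_ι_apply]
      | radsq a b => simp [FreeAlgebra.lift_ι_apply]⟩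

/-- The ring homomorphism `Aᵐᵒᵖ → k` corresponding to the vertex `i`. -/
noncomputable def simpleRingHom (k : Type) [Field k] (i : Fin 3) : Aop k →+* k :=
  RingHom.fromOpposite (simpleAlgHom k i).toRingHom (fun _ _ => mul_comm _ _)

/-- The simple right `A`-module `S_{i+1}` at the vertex `i` (one-dimensional over `k`,
with `e i` acting as the identity and all arrows acting by zero).
So `SimpleS k 0 = S₁`, `SimpleS k 1 = S₂` and `SimpleS k 2 = S₃`. -/
def SimpleS (k : Type) [Field k] (_i : Fin 3) : Type := k

instance (k : Type) [Field k] (i : Fin 3) : AddCommGroup (SimpleS k i) :=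
  inferInstanceAs (AddCommGroup k)

instance (k : Type) [Field k] (i : Fin 3) : Module k (SimpleS k i) :=
  inferInstanceAs (Module k k)

noncomputable instance (k : Type) [Field k] (i : Fin 3) : Module (Aop k) (SimpleS k i) :=
  Module.compHom (SimpleS k i) (simpleRingHom k i)

/-- The underlying type of `D(A) = Hom_k(A, k)`. -/
abbrev DualA (k : Type) [Field k] : Type := AlgA k →ₗ[k] k

/-- The right `A`-module structure on `D(A)`: `(φ · a) x = φ (a * x)`. -/
noncomputable instance (k : Type) [Field k] : Module (Aop k) (DualA k) where
  smul a φ := φ.comp (LinearMap.mulLeft k a.unop)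
  one_smul φ := by
    show φ.comp (LinearMap.mulLeft k ((1 : Aop k).unop)) = φ
    ext x; simp
  mul_smul a b φ := by
    show φ.comp (LinearMap.mulLeft k ((a * b).unop)) =
      (φ.comp (LinearMap.mulLeft k b.unop)).comp (LinearMap.mulLeft k a.unop)
    ext x; simp [mul_assoc]
  smul_zero a := by
    show (0 : DualA k).comp (LinearMap.mulLeft k a.unop) = 0
    ext x; simp
  smul_add a φ ψ := by
    show (φ + ψ).comp (LinearMap.mulLeft k a.unop) =
      φ.comp (LinearMap.mulLeft k a.unop) + ψ.comp (LinearMap.mulLeft k a.unop)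
    ext x; simp
  add_smul a b φ := by
    show φ.comp (LinearMap.mulLeft k ((a + b).unop)) =
      φ.comp (LinearMap.mulLeft k a.unop) + φ.comp (LinearMap.mulLeft k b.unop)
    ext x; simp [add_mul]
  zero_smul φ := by
    show φ.comp (LinearMap.mulLeft k ((0 : Aop k).unop)) = 0
    ext x; simp

/-- The right `A`-module `M = A ⊕ D(A)`, where `A` carries the right regular
`A`-module structure. -/
abbrev MA (k : Type) [Field k] : Type := AlgA k × DualA k

/-- `X` belongs to `add M`: `X` is (isomorphic to) a direct summand of `Mⁿ` for some `n`. -/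
def InAdd (k : Type) [Field k] (M X : Type) [AddCommGroup M] [Module (Aop k) M]
    [AddCommGroup X] [Module (Aop k) X] : Prop :=
  ∃ (n : ℕ) (ι : X →ₗ[Aop k] (Fin n → M)) (π : (Fin n → M) →ₗ[Aop k] X),
    π.comp ι = LinearMap.id

/-- `Ext^i_A(X, Y)` for right `A`-modules `X` and `Y`, computed in the abelian
category of all right `A`-modules (which has the same `Ext` groups as `mod A`). -/
noncomputable def ExtA (k : Type) [Field k] (X Y : Type) [AddCommGroup X] [Module (Aop k) X]
    [AddCommGroup Y] [Module (Aop k) Y] (i : ℕ) : Type :=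
  ((Ext ℤ (ModuleCat (Aop k)) i).obj (op (ModuleCat.of (Aop k) X))).obj (ModuleCat.of (Aop k) Y)

/-- If every extension of `X` by `Y` splits, then a map `f : P₁ → Y` vanishing on the kernel
of a presentation map `d : P₁ → P₀` of `X` extends along `d`. -/
theorem exists_comp_eq_of_extensions_split {R P₁ P₀ X Y : Type} [Ring R]
    [AddCommGroup P₁] [Module R P₁] [AddCommGroup P₀] [Module R P₀]
    [AddCommGroup X] [Module R X] [AddCommGroup Y] [Module R Y]
    (H : ∀ (E : Type) [AddCommGroup E] [Module R E] (i : Y →ₗ[R] E) (p : E →ₗ[R] X),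
      Function.Injective i → Function.Surjective p → Function.Exact i p →
        ∃ s : X →ₗ[R] E, p ∘ₗ s = LinearMap.id)
    (d : P₁ →ₗ[R] P₀) (π : P₀ →ₗ[R] X) (hπ : Function.Surjective π) (hd : Function.Exact d π)
    (f : P₁ →ₗ[R] Y) (hf : LinearMap.ker d ≤ LinearMap.ker f) :
    ∃ h : P₀ →ₗ[R] Y, h ∘ₗ d = f := by
  let N : Submodule R (P₀ × Y) := LinearMap.range (d.prod (-f))
  let i : Y →ₗ[R] (P₀ × Y) ⧸ N := N.mkQ ∘ₗ LinearMap.inr R P₀ Y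
  let j : P₀ →ₗ[R] (P₀ × Y) ⧸ N := N.mkQ ∘ₗ LinearMap.inl R P₀ Y
  have hN : N ≤ LinearMap.ker (π ∘ₗ LinearMap.fst R P₀ Y) := by
    rintro _ ⟨x, rfl⟩
    exact hd.apply_apply_eq_zero x
  let p : ((P₀ × Y) ⧸ N) →ₗ[R] X := N.liftQ (π ∘ₗ LinearMap.fst R P₀ Y) hN
  have hi : Function.Injective i := by
    rw [injective_iff_map_eq_zero]
    intro y hy
    obtain ⟨x, hx⟩ := (Submodule.Quotient.mk_eq_zero N).1 hy
    have h₁ : d x = 0 := congrArg Prod.fst hx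
    have h₂ : -f x = y := congrArg Prod.snd hx
    rw [← h₂, LinearMap.mem_ker.1 (hf h₁), neg_zero]
  have hij (x : P₁) : j (d x) = i (f x) := by
    refine (Submodule.Quotient.eq N).2 ⟨x, ?_⟩
    ext <;> simp
  have hp : Function.Surjective p := fun x => by
    obtain ⟨z, rfl⟩ := hπ x
    exact ⟨j z, rfl⟩
  have hex : Function.Exact i p := by
    intro e
    constructor
    · intro he
      obtain ⟨⟨z, y⟩, rfl⟩ := N.mkQ_surjective e
      obtain ⟨x, rfl⟩ := (hd z).1 he
      refine ⟨f x + y, ?_⟩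
      rw [map_add, ← hij]
      change N.mkQ (d x, 0) + N.mkQ (0, y) = _
      rw [← map_add]
      simp
    · rintro ⟨y, rfl⟩
      exact map_zero π
  obtain ⟨s, hs⟩ := H _ i p hi hp hex
  have hmem (z : P₀) : (j - s ∘ₗ π) z ∈ LinearMap.range i := by
    refine (hex _).1 ?_
    have h₁ : p (s (π z)) = π z := LinearMap.congr_fun hs (π z)
    have h₂ : p (j z) = π z := rfl
    simp [h₁, h₂]
  let r := (LinearEquiv.ofInjective i hi).symm
  refine ⟨r.toLinearMap ∘ₗ (j - s ∘ₗ π).codRestrict (LinearMap.range i) hmem, ?_⟩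
  ext x
  change r _ = f x
  rw [LinearEquiv.symm_apply_eq]
  ext
  simp [hd.apply_apply_eq_zero, hij]

/-- If every extension of `X` by `Y` splits, then `Ext¹(X, Y)` vanishes. -/
theorem subsingleton_ext_one_of_extensions_split {R : Type} [Ring R] (X Y : ModuleCat.{0} R)
    (H : ∀ (E : Type) [AddCommGroup E] [Module R E] (i : Y →ₗ[R] E) (p : E →ₗ[R] X),
      Function.Injective i → Function.Surjective p → Function.Exact i p →
        ∃ s : X →ₗ[R] E, p ∘ₗ s = LinearMap.id) :
    Subsingleton (((Ext ℤ (ModuleCat R) 1).obj (op X)).obj Y) := by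
  let P := projectiveResolution X
  rw [← ModuleCat.isZero_iff_subsingleton]
  refine Limits.IsZero.of_iso ?_ (P.isoExt 1 Y)
  rw [← HomologicalComplex.exactAt_iff_isZero_homology,
    HomologicalComplex.exactAt_iff' _ 0 1 2 (by simp) (by simp),
    ShortComplex.moduleCat_exact_iff]
  intro (f : P.complex.X 1 ⟶ Y) (hf : P.complex.d 2 1 ≫ f = 0)
  have h₀ : Function.Exact (P.complex.d 1 0).hom (P.π.f 0).hom :=
    (ShortComplex.ShortExact.moduleCat_exact_iff_function_exact _).1
      (ShortComplex.exact_of_g_is_cokernel (ShortComplex.mk _ _ P.complex_d_comp_π_f_zero)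
        P.isColimitCokernelCofork)
  have h₁ : Function.Exact (P.complex.d 2 1).hom (P.complex.d 1 0).hom :=
    (ShortComplex.ShortExact.moduleCat_exact_iff_function_exact _).1 (P.exact_succ 0)
  have hπ : Function.Surjective (P.π.f 0).hom :=
    (ModuleCat.epi_iff_surjective (P.π.f 0)).1 inferInstance
  obtain ⟨h, hh⟩ := exists_comp_eq_of_extensions_split H _ _ hπ h₀ f.hom (by
    intro x hx
    obtain ⟨y, rfl⟩ := (h₁ x).1 hx
    exact LinearMap.congr_fun (congrArg ModuleCat.Hom.hom hf) y)
  exact ⟨ModuleCat.ofHom h, ModuleCat.hom_ext hh⟩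

namespace AlgA

variable (k : Type) [Field k]

/-- The vertex idempotents of `A`. -/
noncomputable def e (i : Fin 3) : AlgA k :=
  RingQuot.mkAlgHom k (ARel k) (FreeAlgebra.ι k (QGen.e i))

/-- The arrows of `Q` as elements of `A`. -/
noncomputable def ar (a : Fin 4) : AlgA k :=
  RingQuot.mkAlgHom k (ARel k) (FreeAlgebra.ι k (QGen.ar a))

theorem e_mul_e (i j : Fin 3) : e k i * e k j = if i = j then e k i else 0 := by
  have h := RingQuot.mkAlgHom_rel k (ARel.idem (k := k) i j)
  rw [map_mul, apply_ite (RingQuot.mkAlgHom k (ARel k)), map_zero] at h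
  exact h

theorem e_sum : e k 0 + e k 1 + e k 2 = 1 := by
  have h := RingQuot.mkAlgHom_rel k (ARel.sum (k := k))
  rw [map_add, map_add, map_one] at h
  exact h

theorem ar_mul_ar (a b : Fin 4) : ar k a * ar k b = 0 := by
  have h := RingQuot.mkAlgHom_rel k (ARel.radsq (k := k) a b)
  rw [map_mul, map_zero] at h
  exact h

theorem e_mul_ar (i : Fin 3) (a : Fin 4) :
    e k i * ar k a = if i = arrowSrc a then ar k a else 0 := by
  have h : e k (arrowSrc a) * ar k a = ar k a := by
    have h := RingQuot.mkAlgHom_rel k (ARel.src (k := k) a)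
    rw [map_mul] at h
    exact h
  split_ifs with hi
  · rw [hi, h]
  · rw [← h, ← mul_assoc, e_mul_e, if_neg hi, zero_mul]

theorem ar_mul_e (a : Fin 4) (i : Fin 3) :
    ar k a * e k i = if arrowTgt a = i then ar k a else 0 := by
  have h : ar k a * e k (arrowTgt a) = ar k a := by
    have h := RingQuot.mkAlgHom_rel k (ARel.tgt (k := k) a)
    rw [map_mul] at h
    exact h
  split_ifs with hi
  · rw [← hi, h]
  · rw [← h, mul_assoc, e_mul_e, if_neg hi, mul_zero]

/-- The representation of `A` on upper triangular `2 × 2` matrices attached to an arrow. -/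
noncomputable def arrowRep (a : Fin 4) : AlgA k →ₐ[k] Matrix (Fin 2) (Fin 2) k :=
  RingQuot.liftAlgHom k
    ⟨FreeAlgebra.lift k (fun g => match g with
        | QGen.e j => !![if j = arrowSrc a then 1 else 0, 0; 0, if j = arrowTgt a then 1 else 0]
        | QGen.ar b => !![0, if b = a then 1 else 0; 0, 0]), by
      intro _x _y h
      induction h with
      | idem i j =>
          ext p q
          fin_cases p <;> fin_cases q <;> simp [FreeAlgebra.lift_ι_apply] <;> aesop
      | sum =>
          ext p q
          fin_cases a <;> fin_cases p <;> fin_cases q <;>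
            simp [FreeAlgebra.lift_ι_apply, arrowSrc, arrowTgt]
      | src b =>
          ext p q
          fin_cases p <;> fin_cases q <;> simp [FreeAlgebra.lift_ι_apply] <;> aesop
      | tgt b =>
          ext p q
          fin_cases p <;> fin_cases q <;> simp [FreeAlgebra.lift_ι_apply] <;> aesop
      | radsq b c =>
          ext p q
          fin_cases p <;> fin_cases q <;> simp [FreeAlgebra.lift_ι_apply] <;> aesop⟩

theorem arrowRep_e (a : Fin 4) (j : Fin 3) : arrowRep k a (e k j) =
    !![if j = arrowSrc a then 1 else 0, 0; 0, if j = arrowTgt a then 1 else 0] := by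
  simp [arrowRep, e, FreeAlgebra.lift_ι_apply]

theorem arrowRep_ar (a b : Fin 4) :
    arrowRep k a (ar k b) = !![0, if b = a then 1 else 0; 0, 0] := by
  simp [arrowRep, ar, FreeAlgebra.lift_ι_apply]

/-- The coordinate functional of an arrow, an element of `D(A)`. -/
noncomputable def arDual (a : Fin 4) : DualA k :=
  Matrix.entryLinearMap k k 0 1 ∘ₗ (arrowRep k a).toLinearMap

theorem arDual_e (a : Fin 4) (i : Fin 3) : arDual k a (e k i) = 0 := by
  simp [arDual, arrowRep_e]

theorem arDual_ar (a b : Fin 4) : arDual k a (ar k b) = if b = a then 1 else 0 := by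
  simp [arDual, arrowRep_ar]

theorem ar_ne_zero (a : Fin 4) : ar k a ≠ 0 := by
  intro h
  simpa [h] using arDual_ar k a a

variable {k}

/-- The algebra `A` is spanned by the vertex idempotents and the arrows. -/
theorem exists_eq_sum (x : AlgA k) :
    ∃ (c : Fin 3 → k) (d : Fin 4 → k), x = ∑ i, c i • e k i + ∑ a, d a • ar k a := by
  obtain ⟨x, rfl⟩ := RingQuot.mkAlgHom_surjective k (ARel k) x
  induction x using FreeAlgebra.induction with
  | grade0 r =>
      refine ⟨fun _ => r, 0, ?_⟩
      rw [AlgHom.commutes, Algebra.algebraMap_eq_smul_one, ← e_sum]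
      simp [Fin.sum_univ_three]
  | grade1 g =>
      cases g with
      | e i => exact ⟨Pi.single i 1, 0, by simp [Pi.single_apply, e]⟩
      | ar a => exact ⟨0, Pi.single a 1, by simp [Pi.single_apply, ar]⟩
  | mul x y hx hy =>
      obtain ⟨c, d, hx⟩ := hx
      obtain ⟨c', d', hy⟩ := hy
      refine ⟨fun i => c i * c' i, fun a => c (arrowSrc a) * d' a + d a * c' (arrowTgt a), ?_⟩
      rw [map_mul, hx, hy]
      simp only [add_mul, mul_add, Finset.sum_mul_sum, smul_mul_smul_comm, e_mul_e, e_mul_ar,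
        ar_mul_e, ar_mul_ar, smul_zero, smul_ite, Finset.sum_const_zero, add_zero]
      rw [Finset.sum_comm (s := (Finset.univ : Finset (Fin 3)))
        (t := (Finset.univ : Finset (Fin 4)))]
      simp only [Finset.sum_ite_eq, Finset.sum_ite_eq', Finset.mem_univ, if_true, add_smul,
        Finset.sum_add_distrib]
      simp [add_assoc, add_comm]
  | add x y hx hy =>
      obtain ⟨c, d, hx⟩ := hx
      obtain ⟨c', d', hy⟩ := hy
      refine ⟨c + c', d + d', ?_⟩
      rw [map_add, hx, hy]
      simp only [Pi.add_apply, add_smul, Finset.sum_add_distrib]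
      abel

theorem dual_ext {φ ψ : DualA k} (he : ∀ i, φ (e k i) = ψ (e k i))
    (har : ∀ a, φ (ar k a) = ψ (ar k a)) : φ = ψ := by
  ext x
  obtain ⟨c, d, rfl⟩ := exists_eq_sum x
  simp [he, har]

theorem op_smul_dual_apply (x : AlgA k) (φ : DualA k) (y : AlgA k) :
    (MulOpposite.op x • φ) y = φ (x * y) := rfl

instance : IsScalarTower k (Aop k) (DualA k) where
  smul_assoc c r φ := by
    ext x
    change φ ((c • r.unop) * x) = c • φ (r.unop * x)
    simp

/-- The socle of a right `A`-module `Y` is contained in its radical `Y J`. -/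
def SocleLERadical (k : Type) [Field k] (Y : Type) [AddCommGroup Y] [Module (Aop k) Y] : Prop :=
  ∀ y : Y, (∀ a, MulOpposite.op (ar k a) • y = 0) →
    ∃ c : Fin 4 → Y, y = ∑ a, MulOpposite.op (ar k a) • c a

theorem socleLERadical_self : SocleLERadical k (AlgA k) := by
  intro y hy
  obtain ⟨c, d, rfl⟩ := exists_eq_sum y
  have hc : c = 0 := by
    have h (b : Fin 4) : c (arrowSrc b) = 0 := by
      have := hy b
      simp only [op_smul_eq_mul, add_mul, Finset.sum_mul, smul_mul_assoc, e_mul_ar,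
        ar_mul_ar] at this
      simpa [ar_ne_zero] using this
    funext i
    fin_cases i
    exacts [h 0, h 1, h 3]
  exact ⟨fun a => algebraMap k (AlgA k) (d a), by simp [hc, Algebra.smul_def]⟩

theorem ar_smul_arDual (a b : Fin 4) (hab : a ≠ b) :
    MulOpposite.op (ar k a) • arDual k b = 0 := by
  refine dual_ext (fun i => ?_) fun c => ?_
  · rw [op_smul_dual_apply, ar_mul_e]
    split_ifs <;> simp [arDual_ar, hab]
  · rw [op_smul_dual_apply, ar_mul_ar]
    simp

theorem ar_smul_arDual_self_e (a : Fin 4) (i : Fin 3) :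
    (MulOpposite.op (ar k a) • arDual k a) (e k i) = if arrowTgt a = i then 1 else 0 := by
  rw [op_smul_dual_apply, ar_mul_e]
  split_ifs <;> simp [arDual_ar]

theorem ar_smul_arDual_ar (a b c : Fin 4) :
    (MulOpposite.op (ar k a) • arDual k b) (ar k c) = 0 := by
  rw [op_smul_dual_apply, ar_mul_ar, map_zero]

theorem e_smul_arDual (a : Fin 4) :
    MulOpposite.op (e k (arrowSrc a)) • arDual k a = arDual k a := by
  refine dual_ext (fun i => ?_) fun c => ?_
  · rw [op_smul_dual_apply, e_mul_e]
    split_ifs <;> simp [arDual_e]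
  · rw [op_smul_dual_apply, e_mul_ar]
    split_ifs with h
    · rfl
    · rw [arDual_ar, if_neg (by rintro rfl; exact h rfl), map_zero]

/-- The dual basis expansion of an element of `D(A)`. -/
theorem dual_eq_sum (φ : DualA k) : φ = ∑ a, φ (ar k a) • arDual k a +
    (φ (e k 0) • MulOpposite.op (ar k 1) • arDual k 1 +
      φ (e k 1) • MulOpposite.op (ar k 0) • arDual k 0 +
      φ (e k 2) • MulOpposite.op (ar k 2) • arDual k 2) := by
  refine dual_ext (fun i => ?_) fun c => ?_
  · simp only [LinearMap.add_apply, LinearMap.sum_apply, LinearMap.smul_apply, arDual_e,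
      ar_smul_arDual_self_e]
    fin_cases i <;> simp [arrowTgt]
  · simp only [LinearMap.add_apply, LinearMap.sum_apply, LinearMap.smul_apply, arDual_ar,
      ar_smul_arDual_ar]
    simp

theorem span_range_arDual : Submodule.span (Aop k) (Set.range (arDual k)) = ⊤ := by
  have h (a : Fin 4) : arDual k a ∈ Submodule.span (Aop k) (Set.range (arDual k)) :=
    Submodule.subset_span ⟨a, rfl⟩
  refine eq_top_iff.2 fun φ _ => ?_
  rw [dual_eq_sum φ]
  refine add_mem (sum_mem fun a _ => Submodule.smul_of_tower_mem _ _ (h a))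
    (add_mem (add_mem ?_ ?_) ?_) <;>
  exact Submodule.smul_of_tower_mem _ _ (Submodule.smul_mem _ _ (h _))

theorem socleLERadical_dual : SocleLERadical k (DualA k) := by
  intro φ hφ
  have h (a : Fin 4) : φ (ar k a) = 0 := by
    simpa [op_smul_dual_apply] using LinearMap.congr_fun (hφ a) 1
  refine ⟨![φ (e k 1) • arDual k 0, φ (e k 0) • arDual k 1, φ (e k 2) • arDual k 2, 0], ?_⟩
  conv_lhs => rw [dual_eq_sum φ]
  have hs (x : AlgA k) (c : k) (ψ : DualA k) :
      MulOpposite.op x • c • ψ = c • MulOpposite.op x • ψ := by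
    ext; simp [op_smul_dual_apply]
  simp only [h, zero_smul, Finset.sum_const_zero, zero_add, Fin.sum_univ_four, Matrix.cons_val,
    hs, smul_zero, add_zero]
  abel

theorem SocleLERadical.prod {Y Z : Type} [AddCommGroup Y] [Module (Aop k) Y] [AddCommGroup Z]
    [Module (Aop k) Z] (hY : SocleLERadical k Y) (hZ : SocleLERadical k Z) :
    SocleLERadical k (Y × Z) := by
  intro y hy
  obtain ⟨c, hc⟩ := hY y.1 fun a => congrArg Prod.fst (hy a)
  obtain ⟨d, hd⟩ := hZ y.2 fun a => congrArg Prod.snd (hy a)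
  refine ⟨fun a => (c a, d a), Prod.ext ?_ ?_⟩
  · simpa [Prod.fst_sum] using hc
  · simpa [Prod.snd_sum] using hd

/-- `D(A)` is presented by the generators `arDual k a` with the relations
satisfied by `m` in the hypotheses. -/
theorem exists_dual_hom {E : Type} [AddCommGroup E] [Module (Aop k) E] [Module k E]
    [IsScalarTower k (Aop k) E] (m : Fin 4 → E) (n : Fin 3 → E)
    (he : ∀ a, MulOpposite.op (e k (arrowSrc a)) • m a = m a)
    (har : ∀ a b, MulOpposite.op (ar k b) • m a = if b = a then n (arrowTgt a) else 0) :
    ∃ s : DualA k →ₗ[Aop k] E, ∀ a, s (arDual k a) = m a := by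
  have : SMulCommClass k (Aop k) E := IsScalarTower.to_smulCommClass
  have hem (i : Fin 3) (a : Fin 4) :
      MulOpposite.op (e k i) • m a = if i = arrowSrc a then m a else 0 := by
    split_ifs with h
    · rw [h, he]
    · rw [← he, ← mul_smul, ← MulOpposite.op_mul, e_mul_e, if_neg (Ne.symm h), MulOpposite.op_zero,
        zero_smul]
  have hn (i : Fin 3) : ∃ a, arrowTgt a = i ∧ n i = MulOpposite.op (ar k a) • m a := by
    obtain ⟨a, rfl⟩ : ∃ a, arrowTgt a = i := by revert i; decide
    exact ⟨a, rfl, by rw [har, if_pos rfl]⟩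
  have hen (j i : Fin 3) : MulOpposite.op (e k j) • n i = if i = j then n i else 0 := by
    obtain ⟨a, rfl, ha⟩ := hn i
    rw [ha, ← mul_smul, ← MulOpposite.op_mul, ar_mul_e]
    split_ifs <;> simp
  have harn (b : Fin 4) (i : Fin 3) : MulOpposite.op (ar k b) • n i = 0 := by
    obtain ⟨a, rfl, ha⟩ := hn i
    rw [ha, ← mul_smul, ← MulOpposite.op_mul, ar_mul_ar, MulOpposite.op_zero, zero_smul]
  let s : DualA k →ₗ[k] E :=
    { toFun := fun φ => ∑ a, φ (ar k a) • m a + ∑ i, φ (e k i) • n i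
      map_add' := fun φ ψ => by
        simp only [LinearMap.add_apply, add_smul, Finset.sum_add_distrib]
        abel
      map_smul' := fun c φ => by
        simp only [LinearMap.smul_apply, smul_assoc, smul_add, Finset.smul_sum, RingHom.id_apply] }
  have hs (φ : DualA k) : s φ = ∑ a, φ (ar k a) • m a + ∑ i, φ (e k i) • n i := rfl
  have hse (i : Fin 3) (φ : DualA k) :
      s (MulOpposite.op (e k i) • φ) = MulOpposite.op (e k i) • s φ := by
    simp only [hs, op_smul_dual_apply, smul_add, Finset.smul_sum,
      smul_comm (MulOpposite.op (e k i)) (_ : k), hem, hen, e_mul_e, e_mul_ar]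
    congr 1 <;> refine Finset.sum_congr rfl fun t _ => ?_
    · split_ifs <;> simp
    · by_cases hit : i = t
      · simp [hit]
      · simp [hit, Ne.symm hit]
  have hsar (b : Fin 4) (φ : DualA k) :
      s (MulOpposite.op (ar k b) • φ) = MulOpposite.op (ar k b) • s φ := by
    simp only [hs, op_smul_dual_apply, smul_add, Finset.smul_sum,
      smul_comm (MulOpposite.op (ar k b)) (_ : k), har, harn, ar_mul_e, ar_mul_ar]
    simp [apply_ite φ, ite_smul]
  refine ⟨{ toFun := s, map_add' := map_add s, map_smul' := fun r φ => ?_ }, fun a => ?_⟩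
  · obtain ⟨c, d, hx⟩ := exists_eq_sum r.unop
    obtain rfl : r = MulOpposite.op (∑ i, c i • e k i + ∑ a, d a • ar k a) := by rw [← hx]; rfl
    simp only [RingHom.id_apply, MulOpposite.op_add, Finset.op_sum, MulOpposite.op_smul, add_smul,
      Finset.sum_smul, smul_assoc, map_add, map_sum, map_smul, hse, hsar]
  · change s (arDual k a) = m a
    simp [hs, arDual_ar, arDual_e]

/-- If the socle of `Y` lies in its radical, then maps from `D(A)` lift along
surjections with kernel `Y`. -/
theorem exists_dual_lift {E X Y : Type} [AddCommGroup E] [Module (Aop k) E] [AddCommGroup X]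
    [Module (Aop k) X] [AddCommGroup Y] [Module (Aop k) Y] (hY : SocleLERadical k Y)
    (i : Y →ₗ[Aop k] E) (p : E →ₗ[Aop k] X) (hi : Function.Injective i)
    (hp : Function.Surjective p) (hip : Function.Exact i p) (j : DualA k →ₗ[Aop k] X) :
    ∃ s : DualA k →ₗ[Aop k] E, p ∘ₗ s = j := by
  have hker (z : E) (hz : p z = 0) (hz' : ∀ a, MulOpposite.op (ar k a) • z = 0) :
      ∃ c : Fin 4 → E, (∀ a, p (c a) = 0) ∧ z = ∑ a, MulOpposite.op (ar k a) • c a := by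
    obtain ⟨y, rfl⟩ := (hip z).1 hz
    obtain ⟨c, hc⟩ := hY y fun a => hi (by rw [map_smul, hz', map_zero])
    exact ⟨fun a => i (c a), fun a => hip.apply_apply_eq_zero _, by
      conv_lhs => rw [hc]
      simp⟩
  have hee (t : Fin 3) (z : E) :
      MulOpposite.op (e k t) • MulOpposite.op (e k t) • z = MulOpposite.op (e k t) • z := by
    rw [← mul_smul, ← MulOpposite.op_mul, e_mul_e, if_pos rfl]
  have hae (a : Fin 4) (t : Fin 3) (z : E) : MulOpposite.op (ar k a) • MulOpposite.op (e k t) • z =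
      if t = arrowSrc a then MulOpposite.op (ar k a) • z else 0 := by
    rw [← mul_smul, ← MulOpposite.op_mul, e_mul_ar]
    split_ifs <;> simp
  have hea (a : Fin 4) (t : Fin 3) (z : E) : MulOpposite.op (e k t) • MulOpposite.op (ar k a) • z =
      if arrowTgt a = t then MulOpposite.op (ar k a) • z else 0 := by
    rw [← mul_smul, ← MulOpposite.op_mul, ar_mul_e]
    split_ifs <;> simp
  have haa (a b : Fin 4) (z : E) : MulOpposite.op (ar k a) • MulOpposite.op (ar k b) • z = 0 := by
    rw [← mul_smul, ← MulOpposite.op_mul, ar_mul_ar, MulOpposite.op_zero, zero_smul]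
  have hkere (t : Fin 3) (z : E) (hz : p z = 0) (hz' : ∀ a, MulOpposite.op (ar k a) • z = 0)
      (hzt : MulOpposite.op (e k t) • z = z) : ∃ c : Fin 4 → E, (∀ a, p (c a) = 0) ∧
        z = ∑ a, if arrowTgt a = t then MulOpposite.op (ar k a) • c a else 0 := by
    obtain ⟨c, hc, h⟩ := hker z hz hz'
    refine ⟨c, hc, ?_⟩
    rw [← hzt, h, Finset.smul_sum]
    simp only [hea]
  have hm (a : Fin 4) : ∃ m : E, p m = j (arDual k a) ∧
      MulOpposite.op (e k (arrowSrc a)) • m = m := by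
    obtain ⟨m, hm⟩ := hp (j (arDual k a))
    exact ⟨MulOpposite.op (e k (arrowSrc a)) • m, by
      rw [map_smul, hm, ← map_smul, e_smul_arDual], hee _ _⟩
  choose m hmp hme using hm
  obtain ⟨c, hc, hcm⟩ := hkere 2 (MulOpposite.op (ar k 2) • m 1)
    (by rw [map_smul, hmp, ← map_smul, ar_smul_arDual _ _ (by decide), map_zero])
    (fun a => haa _ _ _) (by rw [hea, if_pos (by rfl)])
  obtain ⟨d, hd, hdm⟩ := hkere 0 (MulOpposite.op (ar k 1) • m 2)
    (by rw [map_smul, hmp, ← map_smul, ar_smul_arDual _ _ (by decide), map_zero])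
    (fun a => haa _ _ _) (by rw [hea, if_pos (by rfl)])
  have hloop : MulOpposite.op (ar k 0) • arDual k 0 = MulOpposite.op (ar k 3) • arDual k 3 :=
    dual_ext (fun i => by simp only [ar_smul_arDual_self_e]; rfl)
      (fun c => by simp only [ar_smul_arDual_ar])
  obtain ⟨f, hf, hfm⟩ := hkere 1 (MulOpposite.op (ar k 0) • m 0 - MulOpposite.op (ar k 3) • m 3)
    (by rw [map_sub, map_smul, map_smul, hmp, hmp, ← map_smul, ← map_smul, hloop, sub_self])
    (fun a => by rw [smul_sub, haa, haa, sub_zero])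
    (by rw [smul_sub, hea, hea, if_pos (by rfl), if_pos (by rfl)])
  replace hcm : MulOpposite.op (ar k 2) • m 1 = MulOpposite.op (ar k 2) • c 2 := by
    simpa [Fin.sum_univ_four, arrowTgt] using hcm
  replace hdm : MulOpposite.op (ar k 1) • m 2 = MulOpposite.op (ar k 1) • d 1 := by
    simpa [Fin.sum_univ_four, arrowTgt] using hdm
  replace hfm : MulOpposite.op (ar k 0) • m 0 - MulOpposite.op (ar k 3) • m 3 =
      MulOpposite.op (ar k 0) • f 0 + MulOpposite.op (ar k 3) • f 3 := by
    simpa [Fin.sum_univ_four, arrowTgt] using hfm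
  let u : Fin 4 → E := ![-f 0, -c 2, -d 1, f 3]
  have hu (a : Fin 4) : p (u a) = 0 := by
    fin_cases a <;> simp [u, hc, hd, hf]
  let m' : Fin 4 → E := fun a => m a + MulOpposite.op (e k (arrowSrc a)) • u a
  have hm' (a : Fin 4) : p (m' a) = j (arDual k a) := by
    simp [m', hu, hmp]
  have he' (a : Fin 4) : MulOpposite.op (e k (arrowSrc a)) • m' a = m' a := by
    simp [m', hme, hee]
  have hloop' : MulOpposite.op (ar k 0) • m' 0 = MulOpposite.op (ar k 3) • m' 3 := by
    simp only [m', smul_add, hae, arrowSrc, u, Matrix.cons_val, if_true, smul_neg]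
    rw [sub_eq_iff_eq_add] at hfm
    rw [hfm]
    abel
  let n : Fin 3 → E := ![MulOpposite.op (ar k 1) • m' 1, MulOpposite.op (ar k 0) • m' 0,
    MulOpposite.op (ar k 2) • m' 2]
  have hn (a b : Fin 4) :
      MulOpposite.op (ar k b) • m' a = if b = a then n (arrowTgt a) else 0 := by
    by_cases hs : arrowSrc a = arrowSrc b
    · have key : MulOpposite.op (ar k b) • m' a =
          MulOpposite.op (ar k b) • m a + MulOpposite.op (ar k b) • u a := by
        simp [m', hae, hs]
      fin_cases a <;> fin_cases b <;> first
        | exact absurd hs (by decide)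
        | rw [if_pos rfl]; rfl
        | rw [if_pos rfl]; exact hloop'.symm
        | rw [if_neg (by decide), key]; simp [u, hcm, hdm]
    · rw [← he', hae, if_neg hs, if_neg (by rintro rfl; exact hs rfl)]
  let : Module k E := Module.compHom E (algebraMap k (Aop k))
  have : IsScalarTower k (Aop k) E := ⟨fun c r z => by
    rw [Algebra.smul_def, mul_smul]; rfl⟩
  obtain ⟨s, hs⟩ := exists_dual_hom m' n he' hn
  refine ⟨s, LinearMap.ext_on_range span_range_arDual fun a => ?_⟩
  rw [LinearMap.comp_apply, hs, hm']

end AlgA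

/-- The right `A`-module `M = A ⊕ D(A)` is rigid: `Ext¹_A(M, M) = 0`. -/
theorem ext_one_ma_ma_eq_zero (k : Type) [Field k] :
    Subsingleton (ExtA k (MA k) (MA k) 1) := by
  refine subsingleton_ext_one_of_extensions_split _ _ fun E _ _ i p hi hp hip => ?_
  change MA k →ₗ[Aop k] E at i
  change E →ₗ[Aop k] MA k at p
  obtain ⟨s, hs⟩ := AlgA.exists_dual_lift
    (AlgA.socleLERadical_self.prod AlgA.socleLERadical_dual) i p hi hp hip
    (LinearMap.inr (Aop k) (AlgA k) (DualA k))
  have : Module.Projective (Aop k) (AlgA k) :=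
    Module.Projective.of_equiv (MulOpposite.opLinearEquiv (Aop k)).symm
  obtain ⟨t, ht⟩ := Module.projective_lifting_property p (LinearMap.inl (Aop k) (AlgA k) (DualA k)) hp
  refine ⟨t.coprod s, ?_⟩
  change p ∘ₗ t.coprod s = LinearMap.id
  rw [LinearMap.comp_coprod, hs, ht, LinearMap.coprod_inl_inr]
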